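/- Let n be a natural number and let G be a nonempty closed subset of the Euclidean space ℝⁿ (EuclideanSpace ℝ (Fin n)) which is a Chebyshev set: for every x ∈ ℝⁿ there exists a unique y ∈ G with dist x y = infDist x G. Then G, with the subspace topology, is path-connected and simply connected. -/

import Mathlib

open Topology Filter

/-- In a proper metric space, a selection of nearest points of a closed set `G` is continuous
if nearest points in `G` are unique. -/
theorem Metric.continuous_of_unique_nearest {X : Type*} [PseudoMetricSpace X] [ProperSpace X]
    {G : Set X} (hG : IsClosed G) {p : X → X} (hpG : ∀ x, p x ∈ G)
    (hp : ∀ x, dist x (p x) = Metric.infDist x G)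
    (huniq : ∀ x, ∀ y ∈ G, dist x y = Metric.infDist x G → y = p x) :
    Continuous p := by
  refine continuous_iff_continuousAt.2 fun x => ?_
  have hbound : ∀ᶠ z in 𝓝 x, p z ∈ Metric.closedBall x (Metric.infDist x G + 2) := by
    filter_upwards [Metric.ball_mem_nhds x one_pos] with z hz
    have hzx : dist z x < 1 := hz
    rw [Metric.mem_closedBall]
    linarith [dist_triangle_left (p z) x z, hp z,
      Metric.infDist_le_infDist_add_dist (s := G) (x := z) (y := x)]
  refine (isCompact_closedBall _ _).tendsto_nhds_of_unique_mapClusterPt hbound fun y _ hy => ?_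
  obtain ⟨u, hux, huy⟩ := mapClusterPt_iff_ultrafilter.1 hy
  have hux' : Tendsto (fun z : X => z) u (𝓝 x) := hux
  refine huniq x y (hG.mem_of_tendsto huy (Eventually.of_forall hpG)) ?_
  refine tendsto_nhds_unique (hux'.dist huy) ?_
  simpa only [hp, Function.comp_def] using ((Metric.continuous_infDist_pt G).tendsto x).comp hux'

/-- A retract of a contractible space is contractible. -/
theorem ContractibleSpace.of_leftInverse {X Y : Type*} [TopologicalSpace X] [TopologicalSpace Y]
    [ContractibleSpace X] (i : C(Y, X)) (r : C(X, Y)) (h : Function.LeftInverse r i) :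
    ContractibleSpace Y := by
  rw [contractible_iff_id_nullhomotopic]
  have hid : r.comp ((ContinuousMap.id X).comp i) = ContinuousMap.id Y := ContinuousMap.ext h
  exact hid ▸ ((id_nullhomotopic X).comp_left i).comp_right r

theorem chebyshev_pathConnected_simplyConnected
    (n : ℕ) (G : Set (EuclideanSpace ℝ (Fin n)))
    (hne : G.Nonempty) (hG : IsClosed G)
    (hcheb : ∀ x : EuclideanSpace ℝ (Fin n),
      ∃! y, y ∈ G ∧ dist x y = Metric.infDist x G) :
    PathConnectedSpace G ∧ SimplyConnectedSpace G := by
  choose p hp huniq using hcheb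
  have hcont : Continuous p := Metric.continuous_of_unique_nearest hG (fun x => (hp x).1)
    (fun x => (hp x).2) fun x y hy hxy => huniq x y ⟨hy, hxy⟩
  have hfix : ∀ x ∈ G, p x = x := fun x hx =>
    (huniq x x ⟨hx, by rw [dist_self, Metric.infDist_zero_of_mem hx]⟩).symm
  have : ContractibleSpace G := ContractibleSpace.of_leftInverse
    ⟨Subtype.val, continuous_subtype_val⟩
    ⟨fun x => ⟨p x, (hp x).1⟩, hcont.subtype_mk _⟩ fun x => Subtype.ext (hfix x x.2)
  exact ⟨inferInstance, inferInstance⟩
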